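/- There is no pair (a, t) ∈ ℚ × ℚ satisfying a⁷t − 2a⁶t² + a⁵t³ − a⁷ + 13a⁶t − 17a⁵t² + 5a⁴t³ − 7a⁶ + 53a⁵t − 47a⁴t² + 10a³t³ − 6a⁵ + 80a⁴t − 60a³t² + 10a²t³ + 43a⁴ + 42a³t − 38a²t² + 5at³ + 95a³ − 10a²t − 11at² + t³ + 89a² − 19at − t² + 42a − 6t + 9 = 0. Consequently, for a ∈ ℚ \ {0, −1, −2}, the map φ_a has no rational periodic point of period 4. -/

import Mathlib

/-! ### Eisenstein integers -/

/-- The ring `ℤ[ω]`, `ω² = -1 - ω`. -/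
abbrev Eis18 : Type := QuadraticAlgebra ℤ (-1) (-1)

namespace Eis18

/-- The norm form. -/
def nrm (x : Eis18) : ℤ := x.re ^ 2 - x.re * x.im + x.im ^ 2

theorem nrm_mul (x y : Eis18) : nrm (x * y) = nrm x * nrm y := by
  simp only [nrm, QuadraticAlgebra.re_mul, QuadraticAlgebra.im_mul]
  ring

theorem nrm_nonneg (x : Eis18) : 0 ≤ nrm x := by
  unfold nrm
  nlinarith [sq_nonneg (x.re - x.im), sq_nonneg (x.re), sq_nonneg (x.im)]

theorem nrm_pos {x : Eis18} (hx : x ≠ 0) : 0 < nrm x := by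
  rcases (nrm_nonneg x).lt_or_eq with h | h
  · exact h
  · exfalso
    apply hx
    unfold nrm at h
    have h1 : x.re ^ 2 = 0 := by
      nlinarith [sq_nonneg (x.re - x.im), sq_nonneg (x.re), sq_nonneg (x.im)]
    have h2 : x.im ^ 2 = 0 := by
      nlinarith [sq_nonneg (x.re - x.im), sq_nonneg (x.re), sq_nonneg (x.im)]
    ext
    · simpa using h1
    · simpa using h2

theorem exists_round (u N : ℤ) (hN : 0 < N) : ∃ k : ℤ, 2 * (u - k * N) ≤ N ∧ -N ≤ 2 * (u - k * N) := by
  refine ⟨(2 * u + N) / (2 * N), ?_⟩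
  have h1 := Int.emod_add_mul_ediv (2 * u + N) (2 * N)
  have h2 := Int.emod_nonneg (2 * u + N) (b := 2 * N) (by omega)
  have h3 := Int.emod_lt_of_pos (2 * u + N) (b := 2 * N) (by omega)
  constructor <;> nlinarith

theorem exists_quot (x y : Eis18) (hy : y ≠ 0) : ∃ q : Eis18, nrm (x - y * q) < nrm y := by
  have hN := nrm_pos hy
  -- coordinates of x * conj y
  obtain ⟨k, hk1, hk2⟩ := exists_round (x.re * (y.re - y.im) + x.im * y.im) (nrm y) hN
  obtain ⟨l, hl1, hl2⟩ := exists_round (x.im * y.re - x.re * y.im) (nrm y) hN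
  refine ⟨⟨k, l⟩, ?_⟩
  set N := nrm y with hNd
  set A := x.re * (y.re - y.im) + x.im * y.im - k * N with hA
  set B := x.im * y.re - x.re * y.im - l * N with hB
  have key : nrm (x - y * ⟨k, l⟩) * N = A ^ 2 - A * B + B ^ 2 := by
    rw [hA, hB, hNd]
    simp only [nrm, QuadraticAlgebra.re_sub, QuadraticAlgebra.im_sub,
      QuadraticAlgebra.re_mul, QuadraticAlgebra.im_mul]
    ring
  have hb : A ^ 2 - A * B + B ^ 2 < N * N := by
    nlinarith [mul_nonneg (sub_nonneg.2 hk1) (by linarith : (0:ℤ) ≤ 2 * A + N),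
      mul_nonneg (sub_nonneg.2 hl1) (by linarith : (0:ℤ) ≤ 2 * B + N), sq_nonneg (A + B),
      mul_pos hN hN]
  nlinarith

open Classical in
/-- The quotient. -/
noncomputable def quo (x y : Eis18) : Eis18 :=
  if h : y = 0 then 0 else Classical.choose (exists_quot x y h)

theorem quo_spec (x y : Eis18) (h : y ≠ 0) : nrm (x - y * quo x y) < nrm y := by
  unfold quo
  rw [dif_neg h]
  exact Classical.choose_spec (exists_quot x y h)

noncomputable instance instED : EuclideanDomain Eis18 where
  quotient := quo
  quotient_zero := fun a => by simp [quo]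
  remainder := fun x y => x - y * quo x y
  quotient_mul_add_remainder_eq := fun a b => by ring
  r := fun x y => (nrm x).toNat < (nrm y).toNat
  r_wellFounded := (measure (fun x : Eis18 => (nrm x).toNat)).wf
  remainder_lt := fun a b hb => by
    have := quo_spec a b hb
    have := nrm_nonneg (a - b * quo a b)
    omega
  mul_left_not_lt := fun a b hb => by
    have h1 := nrm_pos hb
    have h2 := nrm_nonneg a
    have h3 : nrm a ≤ nrm (a * b) := by
      rw [nrm_mul]; nlinarith
    have h4 := nrm_nonneg (a * b)
    omega

theorem unit_nrm (u : Eis18ˣ) : nrm (u : Eis18) = 1 := by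
  have h : nrm (u : Eis18) * nrm ((u⁻¹ : Eis18ˣ) : Eis18) = 1 := by
    rw [← nrm_mul, Units.mul_inv]
    simp [nrm, QuadraticAlgebra.re_one, QuadraticAlgebra.im_one]
  exact Int.eq_one_of_mul_eq_one_right (nrm_nonneg _) h

theorem nrm_one_cases (x y : ℤ) (h : x ^ 2 - x * y + y ^ 2 = 1) :
    (x = 1 ∧ y = 0) ∨ (x = -1 ∧ y = 0) ∨ (x = 0 ∧ y = 1) ∨ (x = 0 ∧ y = -1) ∨
      (x = 1 ∧ y = 1) ∨ (x = -1 ∧ y = -1) := by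
  have hx1 : x ≤ 1 := by nlinarith [sq_nonneg (x - 2 * y)]
  have hx2 : -1 ≤ x := by nlinarith [sq_nonneg (x - 2 * y)]
  have hy1 : y ≤ 1 := by nlinarith [sq_nonneg (y - 2 * x)]
  have hy2 : -1 ≤ y := by nlinarith [sq_nonneg (y - 2 * x)]
  interval_cases x <;> interval_cases y <;> simp_all

end Eis18

theorem cube_extract (s t r : ℤ) (hst : IsCoprime s t) (h3 : (3 : ℤ) ∣ t)
    (h : s ^ 2 - s * t + t ^ 2 = r ^ 3) :
    ∃ p q : ℤ, s = p ^ 3 + q ^ 3 - 3 * p * q ^ 2 ∧ t = 3 * p * q * (p - q) := by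
  have hs3 : ¬ (3 : ℤ) ∣ s := by
    intro hs
    have := hst.isUnit_of_dvd' hs h3
    rw [Int.isUnit_iff] at this
    omega
  let M : Eis18 := ⟨s, t⟩
  let M' : Eis18 := ⟨s - t, -t⟩
  have hmul : M * M' = (⟨r, 0⟩ : Eis18) ^ 3 := by
    ext
    · simp only [M, M', pow_succ, pow_zero, one_mul, QuadraticAlgebra.re_mul, QuadraticAlgebra.im_mul]
      linear_combination h
    · simp only [M, M', pow_succ, pow_zero, one_mul, QuadraticAlgebra.re_mul, QuadraticAlgebra.im_mul]
      ring
  have hcop : IsCoprime M M' := by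
    have hN3 : IsCoprime (3 : ℤ) (s ^ 2 - s * t + t ^ 2) := by
      rw [Int.prime_three.coprime_iff_not_dvd]
      intro hd
      apply hs3
      obtain ⟨k, rfl⟩ := h3
      obtain ⟨j, hj⟩ := hd
      apply Int.prime_three.dvd_of_dvd_pow (n := 2)
      exact ⟨j + s * k - 3 * k ^ 2, by linarith⟩
    obtain ⟨c, d, hcd⟩ := hst
    obtain ⟨e, f, hef⟩ := hN3
    -- 3 s = 2 (2 s - t) + (2 t - s), 3 t = (2 s - t) + 2 (2 t - s)
    -- 2 s - t = M + M', 2 t - s = ω' M + ω M'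
    let w : Eis18 := ⟨0, 1⟩
    let w' : Eis18 := ⟨-1, -1⟩
    let C : Eis18 := ⟨c * e, 0⟩
    let D : Eis18 := ⟨d * e, 0⟩
    let FF : Eis18 := ⟨f, 0⟩
    refine ⟨C * (2 + w') + D * (1 + 2 * w') + FF * M', C * (2 + w) + D * (1 + 2 * w), ?_⟩
    have h2r : (2 : Eis18).re = 2 := rfl
    have h2i : (2 : Eis18).im = 0 := rfl
    ext
    · simp only [M, M', C, D, FF, w, w', QuadraticAlgebra.re_mul, QuadraticAlgebra.im_mul,
        QuadraticAlgebra.re_add, QuadraticAlgebra.im_add, QuadraticAlgebra.re_one,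
        QuadraticAlgebra.im_one, h2r, h2i]
      linear_combination hef + 3 * e * hcd
    · simp only [M, M', C, D, FF, w, w', QuadraticAlgebra.re_mul, QuadraticAlgebra.im_mul,
        QuadraticAlgebra.re_add, QuadraticAlgebra.im_add, QuadraticAlgebra.re_one,
        QuadraticAlgebra.im_one, h2r, h2i]
      ring
  obtain ⟨d, u, hu⟩ := exists_associated_pow_of_mul_eq_pow' hcop hmul
  have hun := Eis18.unit_nrm u
  unfold Eis18.nrm at hun
  have hre := congrArg QuadraticAlgebra.re hu
  have him := congrArg QuadraticAlgebra.im hu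
  simp only [M, pow_succ, pow_zero, one_mul, QuadraticAlgebra.re_mul, QuadraticAlgebra.im_mul] at hre him
  obtain ⟨k, hk⟩ := h3
  rcases Eis18.nrm_one_cases _ _ hun with ⟨h1, h2⟩ | ⟨h1, h2⟩ | ⟨h1, h2⟩ | ⟨h1, h2⟩ | ⟨h1, h2⟩ | ⟨h1, h2⟩ <;>
    rw [h1, h2] at hre him
  · exact ⟨d.re, d.im, by rw [← hre]; ring, by rw [← him]; ring⟩
  · exact ⟨-d.re, -d.im, by rw [← hre]; ring, by rw [← him]; ring⟩
  all_goals exfalso; apply hs3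
  · exact ⟨-(d.re * d.im * (d.re - d.im)), by rw [← hre]; ring⟩
  · exact ⟨d.re * d.im * (d.re - d.im), by rw [← hre]; ring⟩
  · exact ⟨k - d.re * d.im * (d.re - d.im), by linear_combination him - hre + hk⟩
  · exact ⟨k + d.re * d.im * (d.re - d.im), by linear_combination him - hre + hk⟩

/-! ### Descent -/

theorem not_prime_of_coprime {x y l : ℤ} (h : IsCoprime x y) (hl : Prime l) (hx : l ∣ x)
    (hy : l ∣ y) : False :=
  hl.not_isUnit (h.isUnit_of_dvd' hx hy)

theorem dvd_three_swap {l k : ℤ} (hl : Prime l) (h : l ∣ 3) (hk : l ∣ k) : (3 : ℤ) ∣ k :=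
  ((hl.associated_of_dvd Int.prime_three h).symm.dvd).trans hk

theorem fermat_three (x : ℤ) : (3 : ℤ) ∣ x ^ 3 - x := by
  have h : x % 3 = 0 ∨ x % 3 = 1 ∨ x % 3 = 2 := by omega
  apply Int.dvd_of_emod_eq_zero
  rcases h with h | h | h <;> simp [pow_succ, Int.sub_emod, Int.mul_emod, h]

theorem cube_inj {x y : ℤ} (h : x ^ 3 = y ^ 3) : x = y :=
  (Odd.strictMono_pow (by decide : Odd 3)).injective h

theorem nd_pos {p q : ℤ} : 0 ≤ p ^ 2 - p * q + q ^ 2 := by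
  nlinarith [sq_nonneg (p - q), sq_nonneg p, sq_nonneg q]

/-- Case `3 ∤ Z`. -/
theorem step_one (X Y Z k : ℤ) (hXZ : IsCoprime X Z) (hZ : Z ≠ 0)
    (h : X ^ 3 + Y ^ 3 + Z ^ 3 = 2 * X * Y * Z) (hk : 3 * X + 3 * Y + 2 * Z = 19 * k)
    (h3 : ¬ (3 : ℤ) ∣ Z) :
    ∃ x y z : ℤ, x ≠ 0 ∧ y * z * (y + z + 2 * x) = x ^ 3 ∧ |x| ≤ |Z| := by
  obtain ⟨s, hs⟩ : ∃ s, s = 2 * Z - 3 * X := ⟨_, rfl⟩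
  obtain ⟨t, ht⟩ : ∃ t, t = 3 * (Y - X) := ⟨_, rfl⟩
  have hprod : -k * (s ^ 2 - s * t + t ^ 2) = Z ^ 3 := by
    have : 19 * (-k * (s ^ 2 - s * t + t ^ 2)) = 19 * Z ^ 3 := by
      rw [hs, ht]
      linear_combination (-27) * h +
        ((2 * Z - 3 * X) ^ 2 - (2 * Z - 3 * X) * (3 * (Y - X)) + (3 * (Y - X)) ^ 2) * hk
    linarith
  have hst : IsCoprime s t := by
    apply isCoprime_of_prime_dvd
    · rintro ⟨h1, h2⟩
      rw [h1, h2] at hprod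
      apply hZ
      have : Z ^ 3 = 0 := by rw [← hprod]; ring
      simpa using this
    · intro l hl h1 h2
      have hlZ : l ∣ Z := by
        apply hl.dvd_of_dvd_pow (n := 3)
        rw [← hprod]
        obtain ⟨i, hi⟩ := h1
        obtain ⟨j, hj⟩ := h2
        exact ⟨-k * (s * i - i * t + j * t), by rw [hi, hj]; ring⟩
      have hl3 : ¬ l ∣ 3 := fun h => h3 (dvd_three_swap hl h hlZ)
      have : l ∣ 3 * X := by
        have : 3 * X = 2 * Z - s := by linarith
        rw [this]
        exact dvd_sub (hlZ.mul_left _) h1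
      rcases hl.dvd_or_dvd this with h | h
      · exact hl3 h
      · exact not_prime_of_coprime hXZ hl h hlZ
  have hcop : IsCoprime (-k) (s ^ 2 - s * t + t ^ 2) := by
    apply isCoprime_of_prime_dvd
    · rintro ⟨h1, h2⟩
      rw [h1, h2] at hprod
      apply hZ
      have : Z ^ 3 = 0 := by rw [← hprod]; ring
      simpa using this
    · intro l hl h1 h2
      have hlZ : l ∣ Z := by
        apply hl.dvd_of_dvd_pow (n := 3)
        rw [← hprod]
        exact h1.mul_right _
      have hl3 : ¬ l ∣ 3 := fun h => h3 (dvd_three_swap hl h hlZ)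
      have hxy : l ∣ 3 * (X + Y) := by
        obtain ⟨i, hi⟩ := h1
        obtain ⟨j, hj⟩ := hlZ
        exact ⟨-19 * i - 2 * j, by linear_combination hk - 2 * hj - 19 * hi⟩
      have hxy' : l ∣ X + Y := (hl.dvd_or_dvd hxy).resolve_left hl3
      have : l ∣ 3 * (3 * (3 * (X * X))) := by
        obtain ⟨i, hi⟩ := h2
        obtain ⟨j, hj⟩ := hlZ
        obtain ⟨m, hm⟩ := hxy'
        have hY : Y = l * m - X := by linarith
        rw [hs, ht, hY, hj] at hi
        refine ⟨i - (4 * j ^ 2 * l - 6 * j * (l * m - X) - 6 * j * X + 12 * j * X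
          - 6 * j * X - 6 * j * X + 9 * m * (l * m - 3 * X)), ?_⟩
        linear_combination hi
      have e1 := (hl.dvd_or_dvd this).resolve_left hl3
      have e2 := (hl.dvd_or_dvd e1).resolve_left hl3
      have e3 := (hl.dvd_or_dvd e2).resolve_left hl3
      have e4 : l ∣ X := (hl.dvd_or_dvd e3).elim id id
      exact not_prime_of_coprime hXZ hl e4 hlZ
  obtain ⟨⟨a, ha⟩, ⟨r, hr⟩⟩ := Int.eq_pow_of_mul_eq_pow_odd hcop (by decide) hprod
  obtain ⟨p, q, hp, hq⟩ := cube_extract s t r hst (ht ▸ dvd_mul_right _ _) hr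
  have hZa : Z = a * (p ^ 2 - p * q + q ^ 2) := by
    apply cube_inj
    rw [← hprod, ha, hp, hq]
    ring
  have hrel : 6 * (a * (p ^ 2 - p * q + q ^ 2)) =
      -19 * a ^ 3 + 2 * (p ^ 3 + q ^ 3 - 3 * p * q ^ 2) - 3 * p * q * (p - q) := by
    rw [← hZa, ← hp, ← hq, ← ha]
    linarith
  have hdiv : (3 : ℤ) ∣ p - 2 * a - 2 * q := by
    have f1 := fermat_three a
    have f2 := fermat_three p
    have f3 := fermat_three q
    obtain ⟨i1, f1⟩ := f1
    obtain ⟨i2, f2⟩ := f2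
    obtain ⟨i3, f3⟩ := f3
    have : (3 : ℤ) ∣ 2 * (p - 2 * a - 2 * q) := by
      refine ⟨2 * (a * (p ^ 2 - p * q + q ^ 2)) + 2 * p * q ^ 2 + p * q * (p - q)
        + 19 * i1 - 2 * i2 - 2 * i3 + 5 * a - 2 * q, ?_⟩
      linear_combination (-1) * hrel + 19 * f1 - 2 * f2 - 2 * f3
    omega
  obtain ⟨z, hz⟩ := hdiv
  have ha0 : a ≠ 0 := by
    rintro rfl
    apply hZ
    rw [hZa]; ring
  refine ⟨a, z + q, z, ha0, ?_, ?_⟩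
  · have hpz : p = 2 * a + 3 * z + 2 * q := by linarith
    rw [hpz] at hrel
    have : 27 * ((z + q) * z * (z + q + z + 2 * a)) = 27 * a ^ 3 := by
      linear_combination (-1) * hrel
    linarith
  · rw [hZa, abs_mul]
    have h1 : p ^ 2 - p * q + q ^ 2 ≠ 0 := by
      intro h0
      apply hZ
      rw [hZa, h0]; ring
    have h2 : 1 ≤ |p ^ 2 - p * q + q ^ 2| := Int.one_le_abs h1
    nlinarith [abs_nonneg a]

/-- Case `3 ∣ Z`. -/
theorem step_two (X Y Z k : ℤ) (hXZ : IsCoprime X Z) (hYZ : IsCoprime Y Z) (hZ : Z ≠ 0)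
    (h : X ^ 3 + Y ^ 3 + Z ^ 3 = 2 * X * Y * Z) (hk : 3 * X + 3 * Y + 2 * Z = 19 * k)
    (h3 : (3 : ℤ) ∣ Z) :
    ∃ x y z : ℤ, x ≠ 0 ∧ y * z * (y + z + 2 * x) = x ^ 3 ∧ |x| ≤ |Z| := by
  have hX3 : ¬ (3 : ℤ) ∣ X := fun hX => not_prime_of_coprime hXZ Int.prime_three hX h3
  have hY3 : ¬ (3 : ℤ) ∣ Y := fun hX => not_prime_of_coprime hYZ Int.prime_three hX h3
  have hXY3 : ¬ (3 : ℤ) ∣ X * Y := fun hd =>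
    (Int.prime_three.dvd_or_dvd hd).elim hX3 hY3
  have hm : (3 : ℤ) ∣ X + Y := by
    obtain ⟨i, hi⟩ := fermat_three X
    obtain ⟨j, hj⟩ := fermat_three Y
    obtain ⟨z, hz⟩ := h3
    refine ⟨2 * X * Y * z - 9 * z ^ 3 - i - j, ?_⟩
    rw [hz] at h
    linear_combination h - hi - hj
  obtain ⟨m, hm⟩ := hm
  obtain ⟨z, hz⟩ := h3
  have hX : X = 3 * m - Y := by linarith
  have h9 : (3 : ℤ) ∣ z := by
    have : (3 : ℤ) ∣ 2 * (X * Y) * z := by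
      refine ⟨3 * m ^ 3 - m * (X * Y) + 3 * z ^ 3, ?_⟩
      have : 9 * (2 * (X * Y) * z) = 9 * (3 * (3 * m ^ 3 - m * (X * Y) + 3 * z ^ 3)) := by
        rw [hz] at h
        rw [hX] at h ⊢
        linear_combination (-3) * h
      linarith
    rcases Int.prime_three.dvd_or_dvd this with h | h
    · rcases Int.prime_three.dvd_or_dvd h with h | h
      · omega
      · exact absurd h hXY3
    · exact h
  obtain ⟨n, hn⟩ := h9
  have hZn : Z = 9 * n := by linarith
  have hmn : (3 : ℤ) ∣ m + 2 * n := by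
    have : (3 : ℤ) ∣ (X * Y) * (m + 2 * n) := by
      refine ⟨m ^ 3 + 27 * n ^ 3, ?_⟩
      rw [hZn, hX] at h
      rw [hX]
      have : 9 * ((3 * m - Y) * Y * (m + 2 * n)) = 9 * (3 * (m ^ 3 + 27 * n ^ 3)) := by
        linear_combination (-1) * h
      linarith
    exact (Int.prime_three.dvd_or_dvd this).resolve_left hXY3
  obtain ⟨q0, hq0⟩ := hmn
  have h19 : (19 : ℤ) ∣ q0 := by omega
  obtain ⟨q1, hq1⟩ := h19
  obtain ⟨s, hs⟩ : ∃ s, s = Y - m - 2 * n := ⟨_, rfl⟩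
  obtain ⟨t, ht⟩ : ∃ t, t = m - 4 * n := ⟨_, rfl⟩
  have hn0 : n ≠ 0 := by
    rintro rfl
    exact hZ (by rw [hZn]; ring)
  have hprod : -q1 * (s ^ 2 - s * t + t ^ 2) = n ^ 3 := by
    have e : m + 2 * n = 57 * q1 := by rw [hq0, hq1]; ring
    rw [hZn, hX] at h
    have : 57 * (-q1 * (s ^ 2 - s * t + t ^ 2)) = 57 * n ^ 3 := by
      rw [hs, ht]
      have : 9 * (57 * (-q1 * ((Y - m - 2 * n) ^ 2 - (Y - m - 2 * n) * (m - 4 * n)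
          + (m - 4 * n) ^ 2))) = 9 * (57 * n ^ 3) := by
        linear_combination (9 * ((Y - m - 2 * n) ^ 2 - (Y - m - 2 * n) * (m - 4 * n)
          + (m - 4 * n) ^ 2)) * e - h
      linarith
    linarith
  have hst : IsCoprime s t := by
    apply isCoprime_of_prime_dvd
    · rintro ⟨h1, h2⟩
      rw [h1, h2] at hprod
      apply hn0
      have : n ^ 3 = 0 := by rw [← hprod]; ring
      simpa using this
    · intro l hl h1 h2
      have hln : l ∣ n := by
        apply hl.dvd_of_dvd_pow (n := 3)
        rw [← hprod]
        obtain ⟨i, hi⟩ := h1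
        obtain ⟨j, hj⟩ := h2
        exact ⟨-q1 * (s * i - i * t + j * t), by rw [hi, hj]; ring⟩
      have hlm : l ∣ m := by
        have : m = t + 4 * n := by linarith
        rw [this]
        exact dvd_add h2 (hln.mul_left _)
      have hlY : l ∣ Y := by
        have : Y = s + m + 2 * n := by linarith
        rw [this]
        exact dvd_add (dvd_add h1 hlm) (hln.mul_left _)
      exact not_prime_of_coprime hYZ hl hlY (hZn ▸ hln.mul_left _)
  have hcop : IsCoprime (-q1) (s ^ 2 - s * t + t ^ 2) := by
    apply isCoprime_of_prime_dvd
    · rintro ⟨h1, h2⟩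
      rw [h1, h2] at hprod
      apply hn0
      have : n ^ 3 = 0 := by rw [← hprod]; ring
      simpa using this
    · intro l hl h1 h2
      have hln : l ∣ n := by
        apply hl.dvd_of_dvd_pow (n := 3)
        rw [← hprod]
        exact h1.mul_right _
      have hlm : l ∣ m := by
        obtain ⟨i, hi⟩ := h1
        obtain ⟨j, hj⟩ := hln
        exact ⟨-57 * i - 2 * j, by linear_combination hq0 + 3 * hq1 - 57 * hi - 2 * hj⟩
      have hlY : l ∣ Y := by
        apply hl.dvd_of_dvd_pow (n := 2)
        obtain ⟨i, hi⟩ := h2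
        obtain ⟨j, hj⟩ := hln
        obtain ⟨w, hw⟩ := hlm
        rw [hs, ht, hj, hw] at hi
        refine ⟨i - (-2 * Y * (w + 2 * j) + l * (w + 2 * j) ^ 2 - (Y - l * w - 2 * (l * j)) * (w - 4 * j)
          + l * (w - 4 * j) ^ 2), ?_⟩
        linear_combination hi
      exact not_prime_of_coprime hYZ hl hlY (hZn ▸ hln.mul_left _)
  obtain ⟨⟨a, ha⟩, ⟨r, hr⟩⟩ := Int.eq_pow_of_mul_eq_pow_odd hcop (by decide) hprod
  obtain ⟨p, q, hp, hq⟩ := cube_extract s t r hst (by omega) hr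
  have hna : n = a * (p ^ 2 - p * q + q ^ 2) := by
    apply cube_inj
    rw [← hprod, ha, hp, hq]
    ring
  have hrel : 2 * (a * (p ^ 2 - p * q + q ^ 2)) = -19 * a ^ 3 - p * q * (p - q) := by
    rw [← hna, ← ha]
    have : 3 * (p * q * (p - q)) = t := by rw [hq]; ring
    omega
  have ha0 : a ≠ 0 := by
    rintro rfl
    apply hn0
    rw [hna]; ring
  refine ⟨3 * a, q - p - 2 * a, p - 2 * a, by omega, ?_, ?_⟩
  · linear_combination (-1) * hrel
  · rw [hZn, hna, abs_mul, abs_mul, abs_mul]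
    have h1 : p ^ 2 - p * q + q ^ 2 ≠ 0 := by
      intro h0
      apply hn0
      rw [hna, h0]; ring
    have h2 : 1 ≤ |p ^ 2 - p * q + q ^ 2| := Int.one_le_abs h1
    have h3 : |(3 : ℤ)| = 3 := rfl
    have h4 : |(9 : ℤ)| = 9 := rfl
    rw [h3, h4]
    nlinarith [abs_nonneg a]

/-- From the elliptic curve to the Hesse cubic. -/
theorem to_hesse (x y z : ℤ) (hx : x ≠ 0) (h : y * z * (y + z + 2 * x) = x ^ 3) :
    ∃ u e v : ℤ, IsCoprime u e ∧ IsCoprime u v ∧ IsCoprime e v ∧ u * e * v ≠ 0 ∧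
      u ^ 3 + e ^ 3 + v ^ 3 = 2 * u * e * v ∧ |u * e * v| ≤ |x| := by
  -- divide by the gcd
  obtain ⟨g, x', y', z', hg, rfl, rfl, rfl, hcop⟩ : ∃ g x' y' z' : ℤ, g ≠ 0 ∧ x = g * x' ∧
      y = g * y' ∧ z = g * z' ∧ ∀ l : ℤ, Prime l → l ∣ x' → l ∣ y' → ¬ l ∣ z' := by
    obtain ⟨g, hg⟩ : ∃ g : ℤ, g = ((Int.gcd x (Int.gcd y z) : ℕ) : ℤ) := ⟨_, rfl⟩
    have hgx : g ∣ x := hg ▸ Int.gcd_dvd_left _ _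
    have hgyz : g ∣ (Int.gcd y z : ℤ) := hg ▸ Int.gcd_dvd_right _ _
    have hgy : g ∣ y := hgyz.trans (Int.gcd_dvd_left _ _)
    have hgz : g ∣ z := hgyz.trans (Int.gcd_dvd_right _ _)
    have hg0 : g ≠ 0 := by
      rintro rfl
      exact hx (zero_dvd_iff.1 hgx)
    obtain ⟨x', hx'⟩ := hgx
    obtain ⟨y', hy'⟩ := hgy
    obtain ⟨z', hz'⟩ := hgz
    refine ⟨g, x', y', z', hg0, hx', hy', hz', ?_⟩
    intro l hl h1 h2 h3
    have e : g * l ∣ g := by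
      conv_rhs => rw [hg]
      refine Int.dvd_coe_gcd ?_ (Int.dvd_coe_gcd ?_ ?_)
      · rw [hx']; exact mul_dvd_mul_left _ h1
      · rw [hy']; exact mul_dvd_mul_left _ h2
      · rw [hz']; exact mul_dvd_mul_left _ h3
    have e' : g * l ∣ g * 1 := by simpa using e
    exact hl.not_isUnit (isUnit_of_dvd_one ((mul_dvd_mul_iff_left hg0).1 e'))
  have hx' : x' ≠ 0 := right_ne_zero_of_mul hx
  obtain ⟨w, hw⟩ : ∃ w, w = y' + z' + 2 * x' := ⟨_, rfl⟩
  have hE : y' * z' * w = x' ^ 3 := by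
    apply mul_left_cancel₀ (pow_ne_zero 3 hg)
    rw [hw]
    linear_combination h
  have hy0 : y' ≠ 0 := by
    rintro rfl
    apply hx'
    have : x' ^ 3 = 0 := by rw [← hE]; ring
    simpa using this
  have hz0 : z' ≠ 0 := by
    rintro rfl
    apply hx'
    have : x' ^ 3 = 0 := by rw [← hE]; ring
    simpa using this
  have hyz : IsCoprime y' z' := by
    apply isCoprime_of_prime_dvd (fun h => hy0 h.1)
    intro l hl h1 h2
    refine hcop l hl (hl.dvd_of_dvd_pow (n := 3) ?_) h1 h2
    rw [← hE]
    exact (h1.mul_right _).mul_right _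
  have hyw : IsCoprime y' w := by
    apply isCoprime_of_prime_dvd (fun h => hy0 h.1)
    intro l hl h1 h2
    have hlx : l ∣ x' := hl.dvd_of_dvd_pow (n := 3) (by
      rw [← hE]
      exact (h1.mul_right _).mul_right _)
    refine hcop l hl hlx h1 ?_
    have : z' = w - y' - 2 * x' := by linarith
    rw [this]
    exact dvd_sub (dvd_sub h2 h1) (hlx.mul_left _)
  have hzw : IsCoprime z' w := by
    apply isCoprime_of_prime_dvd (fun h => hz0 h.1)
    intro l hl h1 h2
    have hlx : l ∣ x' := hl.dvd_of_dvd_pow (n := 3) (by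
      rw [← hE]
      exact (h1.mul_left _).mul_right _)
    refine hcop l hl hlx ?_ h1
    have : y' = w - z' - 2 * x' := by linarith
    rw [this]
    exact dvd_sub (dvd_sub h2 h1) (hlx.mul_left _)
  obtain ⟨⟨r, hr⟩, ⟨v, hv⟩⟩ :=
    Int.eq_pow_of_mul_eq_pow_odd (hyw.mul_left hzw) (by decide : Odd 3) hE
  obtain ⟨⟨u, hu⟩, ⟨e, he⟩⟩ := Int.eq_pow_of_mul_eq_pow_odd hyz (by decide : Odd 3) hr
  have hxu : x' = u * e * v := by
    apply cube_inj
    rw [← hE, hu, he, hv]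
    ring
  rw [hu, he] at hyz
  rw [hu, hv] at hyw
  rw [he, hv] at hzw
  rw [IsCoprime.pow_iff (by norm_num) (by norm_num)] at hyz hyw hzw
  refine ⟨u, e, -v, hyz, hyw.neg_right, hzw.neg_right, ?_, ?_, ?_⟩
  · intro h0
    apply hx'
    rw [hxu]
    linarith
  · rw [hu, he, hv, hxu] at hw
    linear_combination (-1) * hw
  · have : u * e * -v = -x' := by rw [hxu]; ring
    rw [this, abs_neg, abs_mul]
    have := Int.one_le_abs hg
    nlinarith [abs_nonneg x']

theorem step (X Y Z : ℤ) (hXZ : IsCoprime X Z) (hYZ : IsCoprime Y Z) (hZ : Z ≠ 0)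
    (h : X ^ 3 + Y ^ 3 + Z ^ 3 = 2 * X * Y * Z) (hk : (19 : ℤ) ∣ 3 * X + 3 * Y + 2 * Z) :
    ∃ u e v : ℤ, IsCoprime u e ∧ IsCoprime u v ∧ IsCoprime e v ∧ u * e * v ≠ 0 ∧
      u ^ 3 + e ^ 3 + v ^ 3 = 2 * u * e * v ∧ |u * e * v| ≤ |Z| := by
  obtain ⟨k, hk⟩ := hk
  obtain ⟨x, y, z, hx, hE, hle⟩ : ∃ x y z : ℤ, x ≠ 0 ∧ y * z * (y + z + 2 * x) = x ^ 3 ∧ |x| ≤ |Z| := by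
    by_cases h3 : (3 : ℤ) ∣ Z
    · exact step_two X Y Z k hXZ hYZ hZ h hk h3
    · exact step_one X Y Z k hXZ hZ h hk h3
  obtain ⟨u, e, v, h1, h2, h3, h4, h5, h6⟩ := to_hesse x y z hx hE
  exact ⟨u, e, v, h1, h2, h3, h4, h5, h6.trans hle⟩

theorem lt_aux (X Y Z : ℤ) (h0 : X * Y * Z ≠ 0) (h : X ^ 3 + Y ^ 3 + Z ^ 3 = 2 * X * Y * Z) :
    |Z| < |X * Y * Z| := by
  rw [abs_mul]
  have hZ : Z ≠ 0 := right_ne_zero_of_mul h0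
  have hXY : X * Y ≠ 0 := left_ne_zero_of_mul h0
  have h1 : 1 ≤ |X * Y| := Int.one_le_abs hXY
  have hZ1 : 1 ≤ |Z| := Int.one_le_abs hZ
  have hne : |X * Y| ≠ 1 := by
    intro h1
    rw [← Int.isUnit_iff_abs_eq, IsUnit.mul_iff, Int.isUnit_iff, Int.isUnit_iff] at h1
    have hpar : ∀ c : ℤ, Z * (Z ^ 2 - 2) = c → (c = 2 ∨ c = -2) → False := by
      intro c hc hc2
      have hd : Z ∣ 2 := by
        rcases hc2 with rfl | rfl
        · exact ⟨_, hc.symm⟩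
        · exact ⟨-(Z ^ 2 - 2), by linarith⟩
      have hle := Int.le_of_dvd (by norm_num) hd
      have hge := Int.le_of_dvd (by norm_num) (Int.neg_dvd.2 hd)
      have : -2 ≤ Z := by linarith
      interval_cases Z <;> omega
    rcases h1 with ⟨rfl | rfl, rfl | rfl⟩
    · exact hpar (-2) (by linarith) (Or.inr rfl)
    · apply hZ
      have : Z * (Z ^ 2 + 2) = 0 := by linarith
      rcases mul_eq_zero.1 this with h | h
      · exact h
      · nlinarith [sq_nonneg Z]
    · apply hZ
      have : Z * (Z ^ 2 + 2) = 0 := by linarith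
      rcases mul_eq_zero.1 this with h | h
      · exact h
      · nlinarith [sq_nonneg Z]
    · exact hpar 2 (by linarith) (Or.inl rfl)
  have h2 : 2 ≤ |X * Y| := by omega
  nlinarith

theorem hesse_aux (n : ℕ) : ∀ X Y Z : ℤ, (X * Y * Z).natAbs = n → IsCoprime X Y → IsCoprime X Z →
    IsCoprime Y Z → X * Y * Z ≠ 0 → X ^ 3 + Y ^ 3 + Z ^ 3 = 2 * X * Y * Z → False := by
  induction n using Nat.strong_induction_on with
  | _ n ih =>
  -- the descent, once the good coordinate has been moved to the last place
  have main : ∀ X Y Z : ℤ, (X * Y * Z).natAbs = n → IsCoprime X Z →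
      IsCoprime Y Z → X * Y * Z ≠ 0 → X ^ 3 + Y ^ 3 + Z ^ 3 = 2 * X * Y * Z →
      (19 : ℤ) ∣ 3 * X + 3 * Y + 2 * Z → False := by
    intro X Y Z hn hXZ hYZ h0 h h19
    obtain ⟨u, e, v, h1, h2, h3, h4, h5, h6⟩ :=
      step X Y Z hXZ hYZ (right_ne_zero_of_mul h0) h h19
    have hlt := lt_aux X Y Z h0 h
    rw [Int.abs_eq_natAbs, Int.abs_eq_natAbs] at hlt h6
    exact ih _ (by omega) u e v rfl h1 h2 h3 h4 h5
  intro X Y Z hn hXY hXZ hYZ h0 h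
  have h19 : (19 : ℤ) ∣ (3 * X + 3 * Y + 2 * Z) * ((3 * Y + 3 * Z + 2 * X) * (3 * X + 3 * Z + 2 * Y)) := by
    refine ⟨(X + Y + Z) ^ 3, ?_⟩
    linear_combination (-1) * h
  have p19 : Prime (19 : ℤ) := by
    rw [← Nat.cast_ofNat, ← Nat.prime_iff_prime_int]
    norm_num
  rcases p19.dvd_or_dvd h19 with h1 | h1
  · exact main X Y Z hn hXZ hYZ h0 h h1
  rcases p19.dvd_or_dvd h1 with h1 | h1
  · refine main Y Z X ?_ hXY.symm hXZ.symm ?_ ?_ h1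
    · rw [← hn]; congr 1; ring
    · intro h; apply h0; linarith
    · linarith
  · refine main X Z Y ?_ hXY hYZ.symm ?_ ?_ ?_
    · rw [← hn]; congr 1; ring
    · intro h; apply h0; linarith
    · linarith
    · exact h1

theorem ell_int (x y z : ℤ) (h : y * z * (y + z + 2 * x) = x ^ 3) : x = 0 := by
  by_contra hx
  obtain ⟨u, e, v, h1, h2, h3, h4, h5, h6⟩ := to_hesse x y z hx h
  exact hesse_aux _ u e v rfl h1 h2 h3 h4 h5

theorem ell_rat (g v : ℚ) (h : v ^ 2 - v * g * (g + 2) - g = 0) : g = 0 := by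
  have hgd : (g.den : ℚ) ≠ 0 := by exact_mod_cast g.den_ne_zero
  have hvd : (v.den : ℚ) ≠ 0 := by exact_mod_cast v.den_ne_zero
  have hg : g * g.den = g.num := Rat.mul_den_eq_num g
  have hv : v * v.den = v.num := Rat.mul_den_eq_num v
  have key := ell_int (g.num * g.den * v.den) (-(v.num * g.den ^ 2)) (g.num ^ 2 * v.den) (by
    have : ((-(v.num * g.den ^ 2) * (g.num ^ 2 * v.den) * (-(v.num * g.den ^ 2) + g.num ^ 2 * v.den
        + 2 * (g.num * g.den * v.den)) : ℤ) : ℚ) = ((g.num * g.den * v.den) ^ 3 : ℤ) := by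
      push_cast
      rw [← hg, ← hv]
      linear_combination (g ^ 2 * (g.den : ℚ) ^ 6 * (v.den : ℚ) ^ 3) * h
    exact_mod_cast this)
  have hk : (g.num : ℤ) = 0 := by
    have h1 : (g.den : ℤ) ≠ 0 := by exact_mod_cast g.den_ne_zero
    have h2 : (v.den : ℤ) ≠ 0 := by exact_mod_cast v.den_ne_zero
    simpa [h1, h2] using key
  exact Rat.zero_of_num_zero hk

theorem core18 (b R : ℚ) (hb : b ≠ 0)
    (h : R ^ 3 + (b ^ 3 + b ^ 2 + 2 * b - 2) * R ^ 2 + (1 - 4 * b - b ^ 2 - b ^ 3) * R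
      + (2 * b + b ^ 3) = 0) : False := by
  obtain ⟨n, hn⟩ : ∃ n, R = 1 + b * n := ⟨(R - 1) / b, by field_simp; ring⟩
  have hc : b ^ 2 + b + 1 ≠ 0 := by nlinarith [sq_nonneg (2 * b + 1)]
  have h1 : n ^ 3 * b + n ^ 2 * (b ^ 3 + b ^ 2 + 2 * b + 1) + n * (b ^ 2 + b) + b = 0 := by
    have : b ^ 2 * (n ^ 3 * b + n ^ 2 * (b ^ 3 + b ^ 2 + 2 * b + 1) + n * (b ^ 2 + b) + b) = 0 := by
      rw [hn] at h
      linear_combination h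
    exact (mul_eq_zero.1 this).resolve_left (pow_ne_zero 2 hb)
  have hnb : n - b ≠ 0 := by
    intro h0
    have hnb : n = b := by linarith
    rw [hnb] at h1
    have : b * (b ^ 2 + b + 1) ^ 2 = 0 := by linear_combination h1
    exact (mul_ne_zero hb (pow_ne_zero 2 hc)) this
  obtain ⟨k, hk⟩ : ∃ k, n = b + k * (b ^ 2 + b + 1) :=
    ⟨(n - b) / (b ^ 2 + b + 1), by rw [div_mul_cancel₀ _ hc]; ring⟩
  have hk0 : k ≠ 0 := by
    rintro rfl
    apply hnb
    rw [hk]; ring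
  have h2 : b + k * (2 * b ^ 2 + 3 * b) + k ^ 2 * (b ^ 3 + 4 * b ^ 2 + 2 * b + 1)
      + k ^ 3 * (b ^ 3 + b ^ 2 + b) = 0 := by
    have : (b ^ 2 + b + 1) ^ 2 * (b + k * (2 * b ^ 2 + 3 * b)
        + k ^ 2 * (b ^ 3 + 4 * b ^ 2 + 2 * b + 1) + k ^ 3 * (b ^ 3 + b ^ 2 + b)) = 0 := by
      rw [hk] at h1
      linear_combination h1
    exact (mul_eq_zero.1 this).resolve_left (pow_ne_zero 2 hc)
  obtain ⟨g, hg⟩ : ∃ g, k * (g - b) = 1 := ⟨1 / k + b, by field_simp; ring⟩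
  have h3 : -b ^ 2 * (g + 1) ^ 2 + b * g * (g + 1) * (g + 2) + g = 0 := by
    have : k ^ 3 * (-b ^ 2 * (g + 1) ^ 2 + b * g * (g + 1) * (g + 2) + g) = 0 := by
      have hh : ∀ w : ℚ, k * w = 1 → k ^ 3 * (b * w ^ 3 + (2 * b ^ 2 + 3 * b) * w ^ 2
        + (b ^ 3 + 4 * b ^ 2 + 2 * b + 1) * w + b ^ 3 + b ^ 2 + b) = 0 := by
        intro w hw
        have : w = k⁻¹ := (eq_inv_of_mul_eq_one_right hw)
        rw [this]
        field_simp
        linear_combination h2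
      linear_combination hh (g - b) hg
    exact (mul_eq_zero.1 this).resolve_left (pow_ne_zero 3 hk0)
  have hg0 : g = 0 := by
    apply ell_rat g (b * (g + 1))
    linear_combination (-1) * h3
  rw [hg0] at h3
  apply hb
  have : b ^ 2 = 0 := by linarith
  simpa using this

/-! ### Polynomial identities by Kronecker substitution

An integral polynomial identity in two variables is checked at one large point, using a bound on
the coefficients of the polynomials. -/

/-- Polynomial expressions in two variables. -/
inductive BiPoly18 : Type
  | vb : BiPoly18
  | vz : BiPoly18
  | num : ℕ → BiPoly18
  | plus : BiPoly18 → BiPoly18 → BiPoly18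
  | opp : BiPoly18 → BiPoly18
  | times : BiPoly18 → BiPoly18 → BiPoly18
  | power : BiPoly18 → ℕ → BiPoly18

namespace BiPoly18

instance : Add BiPoly18 := ⟨plus⟩
instance : Mul BiPoly18 := ⟨times⟩
instance : Neg BiPoly18 := ⟨opp⟩
instance : Sub BiPoly18 := ⟨fun x y => plus x (opp y)⟩
instance : HPow BiPoly18 ℕ BiPoly18 := ⟨power⟩
instance (n : ℕ) : OfNat BiPoly18 n := ⟨num n⟩

/-- Value in a commutative ring. -/
def val {R : Type*} [CommRing R] (b z : R) : BiPoly18 → R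
  | vb => b
  | vz => z
  | num n => (n : R)
  | plus x y => val b z x + val b z y
  | opp x => -val b z x
  | times x y => val b z x * val b z y
  | power x n => val b z x ^ n

/-- Value in `ℤ`, in a form which evaluates well. -/
def valZ (b z : ℤ) : BiPoly18 → ℤ
  | vb => b
  | vz => z
  | num n => Int.ofNat n
  | plus x y => Int.add (valZ b z x) (valZ b z y)
  | opp x => Int.neg (valZ b z x)
  | times x y => Int.mul (valZ b z x) (valZ b z y)
  | power x n => Int.pow (valZ b z x) n

/-- The majorant: all signs are replaced by `+`. -/
def maj (b z : ℕ) : BiPoly18 → ℕ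
  | vb => b
  | vz => z
  | num n => n
  | plus x y => Nat.add (maj b z x) (maj b z y)
  | opp x => maj b z x
  | times x y => Nat.mul (maj b z x) (maj b z y)
  | power x n => Nat.pow (maj b z x) n

/-- The majorant in a commutative semiring. -/
def majR {R : Type*} [CommSemiring R] (b z : R) : BiPoly18 → R
  | vb => b
  | vz => z
  | num n => (n : R)
  | plus x y => majR b z x + majR b z y
  | opp x => majR b z x
  | times x y => majR b z x * majR b z y
  | power x n => majR b z x ^ n

theorem val_hom {R S : Type*} [CommRing R] [CommRing S] (f : R →+* S) (b z : R) (e : BiPoly18) :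
    f (val b z e) = val (f b) (f z) e := by
  induction e <;> simp_all [val]

theorem majR_hom {R S : Type*} [CommSemiring R] [CommSemiring S] (f : R →+* S) (b z : R)
    (e : BiPoly18) : f (majR b z e) = majR (f b) (f z) e := by
  induction e <;> simp_all [majR]

theorem valZ_eq (b z : ℤ) (e : BiPoly18) : valZ b z e = val b z e := by
  induction e with
  | vb => rfl
  | vz => rfl
  | num n => rfl
  | plus x y hx hy => simp only [valZ, val, ← hx, ← hy]; rfl
  | opp x hx => simp only [valZ, val, ← hx]; rfl
  | times x y hx hy => simp only [valZ, val, ← hx, ← hy]; rfl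
  | power x n hx => simp only [valZ, val, ← hx]; rfl

theorem maj_eq (b z : ℕ) (e : BiPoly18) : maj b z e = majR b z e := by
  induction e with
  | vb => rfl
  | vz => rfl
  | num n => rfl
  | plus x y hx hy => simp only [maj, majR, ← hx, ← hy]; rfl
  | opp x hx => simp only [maj, majR, ← hx]
  | times x y hx hy => simp only [maj, majR, ← hx, ← hy]; rfl
  | power x n hx => simp only [maj, majR, ← hx]; rfl

open Polynomial

/-- Coefficientwise domination, one variable. -/
def Dom (f : ℤ[X]) (g : ℕ[X]) : Prop := ∀ i, |f.coeff i| ≤ (g.coeff i : ℤ)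

/-- Coefficientwise domination, two variables. -/
def Dom2 (f : ℤ[X][X]) (g : ℕ[X][X]) : Prop := ∀ i, Dom (f.coeff i) (g.coeff i)

theorem Dom.zero : Dom 0 0 := by intro i; simp

theorem Dom.add {f f' : ℤ[X]} {g g' : ℕ[X]} (h : Dom f g) (h' : Dom f' g') :
    Dom (f + f') (g + g') := by
  intro i
  rw [coeff_add, coeff_add]
  push_cast
  exact (abs_add_le _ _).trans (add_le_add (h i) (h' i))

theorem Dom.sum {ι : Type*} (s : Finset ι) (f : ι → ℤ[X]) (g : ι → ℕ[X])
    (h : ∀ i ∈ s, Dom (f i) (g i)) : Dom (∑ i ∈ s, f i) (∑ i ∈ s, g i) := by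
  classical
  induction s using Finset.induction_on with
  | empty => simpa using Dom.zero
  | insert a s ha ih =>
    rw [Finset.sum_insert ha, Finset.sum_insert ha]
    exact (h a (Finset.mem_insert_self a s)).add
      (ih fun i hi => h i (Finset.mem_insert_of_mem hi))

theorem Dom.mul {f f' : ℤ[X]} {g g' : ℕ[X]} (h : Dom f g) (h' : Dom f' g') :
    Dom (f * f') (g * g') := by
  intro i
  rw [coeff_mul, coeff_mul]
  push_cast
  refine (Finset.abs_sum_le_sum_abs _ _).trans (Finset.sum_le_sum fun x _ => ?_)
  rw [abs_mul]
  exact mul_le_mul (h _) (h' _) (abs_nonneg _) ((abs_nonneg _).trans (h _))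

theorem Dom.neg {f : ℤ[X]} {g : ℕ[X]} (h : Dom f g) : Dom (-f) g := by
  intro i
  rw [coeff_neg, abs_neg]
  exact h i

theorem Dom2.mul {f f' : ℤ[X][X]} {g g' : ℕ[X][X]} (h : Dom2 f g) (h' : Dom2 f' g') :
    Dom2 (f * f') (g * g') := by
  intro i
  rw [coeff_mul, coeff_mul]
  exact Dom.sum _ _ _ fun x _ => (h _).mul (h' _)

theorem Dom.natCast (n : ℕ) : Dom (n : ℤ[X]) (n : ℕ[X]) := by
  intro i
  rw [← C_eq_natCast, ← C_eq_natCast, coeff_C]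
  rcases eq_or_ne i 0 with rfl | hi
  · simp
  · simp [coeff_natCast_ite, hi]

theorem Dom2.natCast (n : ℕ) : Dom2 (n : ℤ[X][X]) (n : ℕ[X][X]) := by
  intro i
  rw [coeff_natCast_ite, coeff_natCast_ite]
  split_ifs
  · exact Dom.natCast n
  · exact_mod_cast Dom.zero

theorem Dom.X : Dom X X := by
  intro i
  rw [coeff_X, coeff_X]
  split_ifs <;> simp

theorem dom_val (e : BiPoly18) :
    Dom2 (val (C X) X e) (majR (C X) X e) := by
  induction e with
  | vb =>
    intro i
    simp only [val, majR, coeff_C]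
    split_ifs
    · exact Dom.X
    · exact Dom.zero
  | vz =>
    intro i
    simp only [val, majR, coeff_X]
    split_ifs
    · exact_mod_cast Dom.natCast 1
    · exact Dom.zero
  | num n => exact Dom2.natCast n
  | plus x y hx hy =>
    intro i
    simp only [val, majR, coeff_add]
    exact (hx i).add (hy i)
  | opp x hx =>
    intro i
    simp only [val, majR, coeff_neg]
    exact (hx i).neg
  | times x y hx hy => exact hx.mul hy
  | power x n hx =>
    simp only [val, majR]
    induction n with
    | zero => simpa using Dom2.natCast 1
    | succ n ih => rw [pow_succ, pow_succ]; exact ih.mul hx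

/-- A polynomial with small coefficients is determined by one value. -/
theorem eq_zero_of_small (f : ℤ[X]) (N : ℤ) (h : ∀ i, |f.coeff i| < N) (h0 : f.eval N = 0) :
    f = 0 := by
  have hN : 0 < N := (abs_nonneg _).trans_lt (h 0)
  ext i
  rw [coeff_zero]
  induction hd : f.natDegree using Nat.strong_induction_on generalizing f i with
  | _ d ih =>
  have hf := f.divX_mul_X_add
  have hc : f.coeff 0 = 0 := by
    refine Int.eq_zero_of_abs_lt_dvd ?_ (h 0)
    rw [← hf, eval_add, eval_mul, eval_X, eval_C] at h0
    exact ⟨-(f.divX.eval N), by linarith⟩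
  rcases i with _ | i
  · exact hc
  · rcases Nat.eq_zero_or_pos d with hd0 | hd0
    · rw [coeff_eq_zero_of_natDegree_lt (by omega)]
    · rw [← coeff_divX]
      refine ih f.divX.natDegree ?_ f.divX (fun j => ?_) ?_ i rfl
      · rw [natDegree_divX_eq_natDegree_tsub_one]; omega
      · rw [coeff_divX]; exact h _
      · rw [← hf, eval_add, eval_mul, eval_X, eval_C, hc, add_zero] at h0
        exact (mul_eq_zero.1 h0).resolve_right hN.ne'

theorem coeff_le_eval_one (g : ℕ[X]) (i : ℕ) : g.coeff i ≤ g.eval 1 := by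
  rw [eval_eq_sum_range]
  simp only [one_pow, mul_one]
  by_cases hi : i ∈ Finset.range (g.natDegree + 1)
  · exact Finset.single_le_sum (f := fun j => g.coeff j) (fun _ _ => Nat.zero_le _) hi
  · rw [Finset.mem_range] at hi
    rw [coeff_eq_zero_of_natDegree_lt (by omega)]
    exact Nat.zero_le _

theorem Dom.abs_eval_le {f : ℤ[X]} {g : ℕ[X]} (h : Dom f g) (n : ℕ) :
    |f.eval (n : ℤ)| ≤ (g.eval n : ℕ) := by
  rw [eval_eq_sum_range' (n := max f.natDegree g.natDegree + 1) (by omega),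
    eval_eq_sum_range' (n := max f.natDegree g.natDegree + 1) (p := g) (by omega)]
  push_cast
  refine (Finset.abs_sum_le_sum_abs _ _).trans (Finset.sum_le_sum fun i _ => ?_)
  rw [abs_mul, abs_pow, Nat.abs_cast]
  exact mul_le_mul_of_nonneg_right (h i) (by positivity)

/-- The Kronecker substitution principle. -/
theorem kronecker (e : BiPoly18) (β ζ : ℕ) (h1 : maj 1 1 e < β) (h2 : maj β 1 e < ζ)
    (h3 : valZ β ζ e = 0) {R : Type*} [CommRing R] (b z : R) : val b z e = 0 := by
  rw [maj_eq] at h1 h2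
  rw [valZ_eq] at h3
  obtain ⟨F, hF⟩ : ∃ F : ℤ[X][X], F = val (C X : ℤ[X][X]) X e := ⟨_, rfl⟩
  obtain ⟨G, hG⟩ : ∃ G : ℕ[X][X], G = majR (C X : ℕ[X][X]) X e := ⟨_, rfl⟩
  have hd : Dom2 F G := by rw [hF, hG]; exact dom_val e
  have hG1 : ∀ n : ℕ, (G.map (evalRingHom n)).eval 1 = majR n 1 e := by
    intro n
    have := majR_hom ((evalRingHom (1 : ℕ)).comp (mapRingHom (evalRingHom n))) (C X) X e
    rw [← hG] at this
    simpa using this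
  have hf : F.map (evalRingHom (β : ℤ)) = 0 := by
    refine eq_zero_of_small _ ζ (fun i => ?_) ?_
    · rw [coeff_map, coe_evalRingHom]
      refine ((hd i).abs_eval_le β).trans_lt ?_
      have := coeff_le_eval_one (G.map (evalRingHom β)) i
      rw [hG1, coeff_map, coe_evalRingHom] at this
      exact_mod_cast this.trans_lt h2
    · have := val_hom ((evalRingHom (ζ : ℤ)).comp (mapRingHom (evalRingHom (β : ℤ)))) (C X) X e
      rw [← hF] at this
      rw [← h3]
      simpa using this
  have hF0 : F = 0 := by
    ext1 i
    rw [coeff_zero]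
    refine eq_zero_of_small _ β (fun j => ?_) ?_
    · refine (hd i j).trans_lt ?_
      have i1 := coeff_le_eval_one (G.coeff i) j
      have i2 := coeff_le_eval_one (G.map (evalRingHom 1)) i
      rw [hG1, coeff_map, coe_evalRingHom] at i2
      exact_mod_cast (i1.trans i2).trans_lt h1
    · have := congrArg (fun p => p.coeff i) hf
      simpa [coeff_map] using this
  have := val_hom (eval₂RingHom (eval₂RingHom (Int.castRingHom R) b) z) (C X) X e
  rw [← hF, hF0, map_zero] at this
  simpa using this.symm

end BiPoly18

/-! ### The period-four cycle -/

/-- The fourth dynatomic polynomial of `φ_a`, `b = a + 1`. -/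
def Phi18 (b z : ℚ) : ℚ :=
  (b) +
      (-5 * b + 6 * b ^ 2) * z ^ 1 +
      (1 + 6 * b - 28 * b ^ 2 + 16 * b ^ 3) * z ^ 2 +
      (-4 + 12 * b + 31 * b ^ 2 - 69 * b ^ 3 + 25 * b ^ 4) * z ^ 3 +
      (4 - 37 * b + 46 * b ^ 2 + 68 * b ^ 3 - 99 * b ^ 4 + 25 * b ^ 5) * z ^ 4 +
      (4 + 21 * b - 121 * b ^ 2 + 94 * b ^ 3 + 85 * b ^ 4 - 91 * b ^ 5 + 16 * b ^ 6) * z ^ 5 +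
      (-11 + 30 * b + 47 * b ^ 2 - 204 * b ^ 3 + 117 * b ^ 4 + 70 * b ^ 5 - 54 * b ^ 6 + 6 * b ^ 7) * z ^ 6 +
      (8 - 48 * b + 80 * b ^ 2 + 52 * b ^ 3 - 204 * b ^ 4 + 87 * b ^ 5 + 41 * b ^ 6 - 19 * b ^ 7 + b ^ 8) * z ^ 7 +
      (-2 + 24 * b - 86 * b ^ 2 + 106 * b ^ 3 + 30 * b ^ 4 - 127 * b ^ 5 + 33 * b ^ 6 + 16 * b ^ 7 - 3 * b ^ 8) * z ^ 8 +
      (-4 * b + 26 * b ^ 2 - 75 * b ^ 3 + 77 * b ^ 4 + 13 * b ^ 5 - 47 * b ^ 6 + 3 * b ^ 7 + 3 * b ^ 8) * z ^ 9 +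
      (-b ^ 2 + 12 * b ^ 3 - 33 * b ^ 4 + 30 * b ^ 5 + 7 * b ^ 6 - 8 * b ^ 7 - b ^ 8) * z ^ 10 +
      (2 * b ^ 4 - 8 * b ^ 5 + 5 * b ^ 6 + 2 * b ^ 7) * z ^ 11 +
      (-b ^ 6) * z ^ 12

/-- Terms of degree `0` and `1` in `z` of the cofactor. -/
def cof_part_0 (b z : BiPoly18) : BiPoly18 :=
  (-b) +
      (16 * b - 15 * b ^ 2) * z ^ 1

/-- Terms of degree `2` and `3` in `z` of the cofactor. -/
def cof_part_2 (b z : BiPoly18) : BiPoly18 :=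
  (-1 - 110 * b + 234 * b ^ 2 - 106 * b ^ 3) * z ^ 2 +
      (15 + 397 * b - 1568 * b ^ 2 + 1611 * b ^ 3 - 469 * b ^ 4) * z ^ 3

/-- Terms of degree `4` and `5` in `z` of the cofactor. -/
def cof_part_4 (b z : BiPoly18) : BiPoly18 :=
  (-97 - 622 * b + 5618 * b ^ 2 - 10510 * b ^ 3 + 6939 * b ^ 4 - 1456 * b ^ 5) * z ^ 4 +
      (345 - 794 * b - 9894 * b ^ 2 + 36860 * b ^ 3 - 44026 * b ^ 4 + 20956 * b ^ 5 - 3367 * b ^ 6) * z ^ 5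

/-- Terms of degree `6` and `7` in `z` of the cofactor. -/
def cof_part_6 (b z : BiPoly18) : BiPoly18 :=
  (-689 + 6107 * b - 1405 * b ^ 2 - 65801 * b ^ 3 + 150422 * b ^ 4 - 129176 * b ^ 5 + 47112 * b ^ 6 - 6006 * b ^ 7) * z ^ 6 +
      (573 - 12891 * b + 47869 * b ^ 2 + 9517 * b ^ 3 - 265380 * b ^ 4 + 428758 * b ^ 5 - 281884 * b ^ 6 + 81653 * b ^ 7 - 8437 * b ^ 8) * z ^ 7

/-- Terms of degree `8` and `9` in `z` of the cofactor. -/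
def cof_part_8 (b z : BiPoly18) : BiPoly18 :=
  (591 + 9964 * b - 103510 * b ^ 2 + 227237 * b ^ 3 + 67892 * b ^ 4 - 739004 * b ^ 5 + 907121 * b ^ 6 - 473858 * b ^ 7 + 111397 * b ^ 8 - 9438 * b ^ 9) * z ^ 8 +
      (-2007 + 10067 * b + 76304 * b ^ 2 - 493143 * b ^ 3 + 743543 * b ^ 4 + 220451 * b ^ 5 - 1517263 * b ^ 6 + 1476365 * b ^ 7 - 626670 * b ^ 8 + 120978 * b ^ 9 - 8437 * b ^ 10) * z ^ 9

/-- Terms of degree `10` and `11` in `z` of the cofactor. -/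
def cof_part_10 (b z : BiPoly18) : BiPoly18 :=
  (1620 - 29930 * b + 73991 * b ^ 2 + 348368 * b ^ 3 - 1593560 * b ^ 4 + 1796006 * b ^ 5 + 464924 * b ^ 6 - 2386483 * b ^ 7 + 1888645 * b ^ 8 - 659472 * b ^ 9 + 104962 * b ^ 10 - 6006 * b ^ 11) * z ^ 10 +
      (782 + 20731 * b - 202208 * b ^ 2 + 325657 * b ^ 3 + 1076564 * b ^ 4 - 3752163 * b ^ 5 + 3331209 * b ^ 6 + 707515 * b ^ 7 - 2944007 * b ^ 8 + 1921799 * b ^ 9 - 554312 * b ^ 10 + 72501 * b ^ 11 - 3367 * b ^ 12) * z ^ 11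

/-- Terms of degree `12` and `13` in `z` of the cofactor. -/
def cof_part_12 (b z : BiPoly18) : BiPoly18 :=
  (-2278 + 12157 * b + 125070 * b ^ 2 - 831049 * b ^ 3 + 980032 * b ^ 4 + 2416537 * b ^ 5 - 6718406 * b ^ 6 + 4851952 * b ^ 7 + 820552 * b ^ 8 - 2887500 * b ^ 9 + 1562044 * b ^ 10 - 370898 * b ^ 11 + 39429 * b ^ 12 - 1456 * b ^ 13) * z ^ 12 +
      (986 - 27758 * b + 81105 * b ^ 2 + 468831 * b ^ 3 - 2344201 * b ^ 4 + 2156133 * b ^ 5 + 4120475 * b ^ 6 - 9390800 * b ^ 7 + 5612281 * b ^ 8 + 752996 * b ^ 9 - 2264548 * b ^ 10 + 1011086 * b ^ 11 - 195382 * b ^ 12 + 16536 * b ^ 13 - 469 * b ^ 14) * z ^ 13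

/-- Terms of degree `14` and `15` in `z` of the cofactor. -/
def cof_part_14 (b z : BiPoly18) : BiPoly18 :=
  (929 + 10124 * b - 157659 * b ^ 2 + 320378 * b ^ 3 + 1220075 * b ^ 4 - 4839410 * b ^ 5 + 3593268 * b ^ 6 + 5500262 * b ^ 7 - 10404502 * b ^ 8 + 5173215 * b ^ 9 + 562111 * b ^ 10 - 1417335 * b ^ 11 + 515516 * b ^ 12 - 79360 * b ^ 13 + 5164 * b ^ 14 - 106 * b ^ 15) * z ^ 14 +
      (-995 + 10315 * b + 49817 * b ^ 2 - 551898 * b ^ 3 + 853367 * b ^ 4 + 2342490 * b ^ 5 - 7592069 * b ^ 6 + 4617181 * b ^ 7 + 5863444 * b ^ 8 - 9203362 * b ^ 9 + 3790727 * b ^ 10 + 346247 * b ^ 11 - 700574 * b ^ 12 + 202760 * b ^ 13 - 23996 * b ^ 14 + 1131 * b ^ 15 - 15 * b ^ 16) * z ^ 15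

/-- Terms of degree `16` and `17` in `z` of the cofactor. -/
def cof_part_16 (b z : BiPoly18) : BiPoly18 :=
  (-1 - 9696 * b + 53146 * b ^ 2 + 154859 * b ^ 3 - 1331293 * b ^ 4 + 1636796 * b ^ 5 + 3448280 * b ^ 6 - 9254399 * b ^ 7 + 4603601 * b ^ 8 + 5049341 * b ^ 9 - 6504273 * b ^ 10 + 2192053 * b ^ 11 + 174748 * b ^ 12 - 267756 * b ^ 13 + 59377 * b ^ 14 - 5086 * b ^ 15 + 155 * b ^ 16 - b ^ 17) * z ^ 16 +
      (353 - 28 * b - 44594 * b ^ 2 + 167155 * b ^ 3 + 339030 * b ^ 4 - 2346758 * b ^ 5 + 2341117 * b ^ 6 + 3992161 * b ^ 7 - 8870918 * b ^ 8 + 3553482 * b ^ 9 + 3526134 * b ^ 10 - 3654920 * b ^ 11 + 988325 * b ^ 12 + 69935 * b ^ 13 - 76295 * b ^ 14 + 12185 * b ^ 15 - 674 * b ^ 16 + 10 * b ^ 17) * z ^ 17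

/-- Terms of degree `18` and `19` in `z` of the cofactor. -/
def cof_part_18 (b z : BiPoly18) : BiPoly18 :=
  (-97 + 2921 * b - 143 * b ^ 2 - 127358 * b ^ 3 + 357500 * b ^ 4 + 554544 * b ^ 5 - 3127858 * b ^ 6 + 2540276 * b ^ 7 + 3693003 * b ^ 8 - 6716843 * b ^ 9 + 2099318 * b ^ 10 + 1990904 * b ^ 11 - 1616323 * b ^ 12 + 341264 * b ^ 13 + 20954 * b ^ 14 - 15229 * b ^ 15 + 1562 * b ^ 16 - 42 * b ^ 17) * z ^ 18 +
      (-55 - 779 * b + 11253 * b ^ 2 + 362 * b ^ 3 - 251110 * b ^ 4 + 549036 * b ^ 5 + 703275 * b ^ 6 - 3214636 * b ^ 7 + 2101404 * b ^ 8 + 2750924 * b ^ 9 - 4010011 * b ^ 10 + 924710 * b ^ 11 + 900624 * b ^ 12 - 553184 * b ^ 13 + 87827 * b ^ 14 + 4313 * b ^ 15 - 1894 * b ^ 16 + 94 * b ^ 17) * z ^ 19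

/-- Terms of degree `20` and `21` in `z` of the cofactor. -/
def cof_part_20 (b z : BiPoly18) : BiPoly18 :=
  (25 - 350 * b - 2824 * b ^ 2 + 26289 * b ^ 3 + 4070 * b ^ 4 - 360703 * b ^ 5 + 623062 * b ^ 6 + 707039 * b ^ 7 - 2572178 * b ^ 8 + 1317114 * b ^ 9 + 1650883 * b ^ 10 - 1871778 * b ^ 11 + 285685 * b ^ 12 + 321351 * b ^ 13 - 142607 * b ^ 14 + 16086 * b ^ 15 + 529 * b ^ 16 - 110 * b ^ 17) * z ^ 20 +
      (3 + 157 * b - 1018 * b ^ 2 - 6205 * b ^ 3 + 40959 * b ^ 4 + 12977 * b ^ 5 - 388729 * b ^ 6 + 529247 * b ^ 7 + 568506 * b ^ 8 - 1604942 * b ^ 9 + 612179 * b ^ 10 + 792948 * b ^ 11 - 671078 * b ^ 12 + 51064 * b ^ 13 + 88087 * b ^ 14 - 26389 * b ^ 15 + 1906 * b ^ 16 + 28 * b ^ 17) * z ^ 21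

/-- Terms of degree `22` and `23` in `z` of the cofactor. -/
def cof_part_22 (b z : BiPoly18) : BiPoly18 :=
  (-2 + 12 * b + 426 * b ^ 2 - 1717 * b ^ 3 - 9201 * b ^ 4 + 44371 * b ^ 5 + 23269 * b ^ 6 - 318787 * b ^ 7 + 336889 * b ^ 8 + 364541 * b ^ 9 - 776155 * b ^ 10 + 199889 * b ^ 11 + 300194 * b ^ 12 - 178439 * b ^ 13 - 525 * b ^ 14 + 17650 * b ^ 15 - 3170 * b ^ 16 + 112 * b ^ 17) * z ^ 22 +
      (-9 * b + 21 * b ^ 2 + 659 * b ^ 3 - 1786 * b ^ 4 - 9631 * b ^ 5 + 33920 * b ^ 6 + 26915 * b ^ 7 - 199487 * b ^ 8 + 159049 * b ^ 9 + 184195 * b ^ 10 - 286330 * b ^ 11 + 38921 * b ^ 12 + 86917 * b ^ 13 - 32692 * b ^ 14 - 3024 * b ^ 15 + 2323 * b ^ 16 - 188 * b ^ 17) * z ^ 23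

/-- Terms of degree `24` and `25` in `z` of the cofactor. -/
def cof_part_24 (b z : BiPoly18) : BiPoly18 :=
  (-16 * b ^ 2 + 18 * b ^ 3 + 634 * b ^ 4 - 1139 * b ^ 5 - 7188 * b ^ 6 + 18206 * b ^ 7 + 21132 * b ^ 8 - 94637 * b ^ 9 + 54216 * b ^ 10 + 71912 * b ^ 11 - 78042 * b ^ 12 + 861 * b ^ 13 + 18139 * b ^ 14 - 3418 * b ^ 15 - 761 * b ^ 16 + 151 * b ^ 17) * z ^ 24 +
      (-14 * b ^ 3 + 5 * b ^ 4 + 388 * b ^ 5 - 413 * b ^ 6 - 3770 * b ^ 7 + 6686 * b ^ 8 + 11483 * b ^ 9 - 33521 * b ^ 10 + 12539 * b ^ 11 + 21046 * b ^ 12 - 14730 * b ^ 13 - 1853 * b ^ 14 + 2408 * b ^ 15 - 64 * b ^ 16 - 70 * b ^ 17) * z ^ 25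

/-- Terms of degree `26` and `27` in `z` of the cofactor. -/
def cof_part_26 (b z : BiPoly18) : BiPoly18 :=
  (-6 * b ^ 4 - 2 * b ^ 5 + 146 * b ^ 6 - 64 * b ^ 7 - 1348 * b ^ 8 + 1585 * b ^ 9 + 4322 * b ^ 10 - 8635 * b ^ 11 + 1639 * b ^ 12 + 4383 * b ^ 13 - 1654 * b ^ 14 - 495 * b ^ 15 + 144 * b ^ 16 + 18 * b ^ 17) * z ^ 26 +
      (-b ^ 5 - b ^ 6 + 31 * b ^ 7 + 4 * b ^ 8 - 314 * b ^ 9 + 210 * b ^ 10 + 1108 * b ^ 11 - 1546 * b ^ 12 + 11 * b ^ 13 + 585 * b ^ 14 - 60 * b ^ 15 - 46 * b ^ 16 - 2 * b ^ 17) * z ^ 27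

/-- Terms of degree `28` and `29` in `z` of the cofactor. -/
def cof_part_28 (b z : BiPoly18) : BiPoly18 :=
  (3 * b ^ 8 + 2 * b ^ 9 - 44 * b ^ 10 + 8 * b ^ 11 + 186 * b ^ 12 - 176 * b ^ 13 - 33 * b ^ 14 + 38 * b ^ 15 + 5 * b ^ 16) * z ^ 28 +
      (-3 * b ^ 11 - b ^ 12 + 19 * b ^ 13 - 10 * b ^ 14 - 4 * b ^ 15) * z ^ 29

/-- Terms of degree `30` and `31` in `z` of the cofactor. -/
def cof_part_30 (b z : BiPoly18) : BiPoly18 :=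
  (b ^ 14) * z ^ 30

/-- The cofactor in the elimination of `z`. -/
def cof_expr (b z : BiPoly18) : BiPoly18 :=
  cof_part_0 b z + cof_part_2 b z + cof_part_4 b z + cof_part_6 b z + cof_part_8 b z +
    cof_part_10 b z + cof_part_12 b z + cof_part_14 b z + cof_part_16 b z + cof_part_18 b z +
    cof_part_20 b z + cof_part_22 b z + cof_part_24 b z + cof_part_26 b z + cof_part_28 b z +
    cof_part_30 b z

/-- `Phi18` as an expression. -/
def phi_expr (b z : BiPoly18) : BiPoly18 :=
  (b) +
      (-BiPoly18.num 5 * b + BiPoly18.num 6 * b ^ 2) * z ^ 1 +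
      (1 + BiPoly18.num 6 * b - BiPoly18.num 28 * b ^ 2 + BiPoly18.num 16 * b ^ 3) * z ^ 2 +
      (-BiPoly18.num 4 + BiPoly18.num 12 * b + BiPoly18.num 31 * b ^ 2 - BiPoly18.num 69 * b ^ 3 + BiPoly18.num 25 * b ^ 4) * z ^ 3 +
      (BiPoly18.num 4 - BiPoly18.num 37 * b + BiPoly18.num 46 * b ^ 2 + BiPoly18.num 68 * b ^ 3 - BiPoly18.num 99 * b ^ 4 + BiPoly18.num 25 * b ^ 5) * z ^ 4 +
      (BiPoly18.num 4 + BiPoly18.num 21 * b - BiPoly18.num 121 * b ^ 2 + BiPoly18.num 94 * b ^ 3 + BiPoly18.num 85 * b ^ 4 - BiPoly18.num 91 * b ^ 5 + BiPoly18.num 16 * b ^ 6) * z ^ 5 +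
      (-BiPoly18.num 11 + BiPoly18.num 30 * b + BiPoly18.num 47 * b ^ 2 - BiPoly18.num 204 * b ^ 3 + BiPoly18.num 117 * b ^ 4 + BiPoly18.num 70 * b ^ 5 - BiPoly18.num 54 * b ^ 6 + BiPoly18.num 6 * b ^ 7) * z ^ 6 +
      (BiPoly18.num 8 - BiPoly18.num 48 * b + BiPoly18.num 80 * b ^ 2 + BiPoly18.num 52 * b ^ 3 - BiPoly18.num 204 * b ^ 4 + BiPoly18.num 87 * b ^ 5 + BiPoly18.num 41 * b ^ 6 - BiPoly18.num 19 * b ^ 7 + b ^ 8) * z ^ 7 +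
      (-BiPoly18.num 2 + BiPoly18.num 24 * b - BiPoly18.num 86 * b ^ 2 + BiPoly18.num 106 * b ^ 3 + BiPoly18.num 30 * b ^ 4 - BiPoly18.num 127 * b ^ 5 + BiPoly18.num 33 * b ^ 6 + BiPoly18.num 16 * b ^ 7 - BiPoly18.num 3 * b ^ 8) * z ^ 8 +
      (-BiPoly18.num 4 * b + BiPoly18.num 26 * b ^ 2 - BiPoly18.num 75 * b ^ 3 + BiPoly18.num 77 * b ^ 4 + BiPoly18.num 13 * b ^ 5 - BiPoly18.num 47 * b ^ 6 + BiPoly18.num 3 * b ^ 7 + BiPoly18.num 3 * b ^ 8) * z ^ 9 +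
      (-b ^ 2 + BiPoly18.num 12 * b ^ 3 - BiPoly18.num 33 * b ^ 4 + BiPoly18.num 30 * b ^ 5 + BiPoly18.num 7 * b ^ 6 - BiPoly18.num 8 * b ^ 7 - b ^ 8) * z ^ 10 +
      (BiPoly18.num 2 * b ^ 4 - BiPoly18.num 8 * b ^ 5 + BiPoly18.num 5 * b ^ 6 + BiPoly18.num 2 * b ^ 7) * z ^ 11 +
      (-b ^ 6) * z ^ 12

/-- The common denominator, as an expression. -/
def den_expr (b z : BiPoly18) : BiPoly18 :=
  z ^ 2 * ((z - 1) * (b * z + 1)) ^ 2 * ((b - 1) * z + 1) ^ 2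
    * ((b + 1) * z ^ 2 - (b - 1) * z - 1) ^ 2

/-- The numerator, as an expression. -/
def num_expr (b z : BiPoly18) : BiPoly18 :=
  b ^ 2 * z * den_expr b z
    + b * ((z - 1) * (b * z + 1)) ^ 3 * ((b - 1) * z + 1) ^ 2 * ((b + 1) * z ^ 2 - (b - 1) * z - 1) ^ 2
    - b ^ 2 * ((b - 1) * z + 1) ^ 3 * ((b + 1) * z ^ 2 - (b - 1) * z - 1) ^ 3 * z ^ 2
    + b * z ^ 4 * (-b ^ 2 * z ^ 2 + (1 - BiPoly18.num 2 * b + b ^ 2) * z + (b - 1))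
      * (((z - 1) * (b * z + 1)) ^ 2 - b * (((b - 1) * z + 1) * ((b + 1) * z ^ 2 - (b - 1) * z - 1)))
      * ((z - 1) * (b * z + 1)) ^ 2
    - (b ^ 3 + BiPoly18.num 2 * b ^ 2 - BiPoly18.num 2 * b) * den_expr b z

/-- The identity to be checked, as an expression. -/
def elim_expr (b z : BiPoly18) : BiPoly18 :=
  num_expr b z ^ 3 + (b ^ 3 + b ^ 2 + BiPoly18.num 2 * b - BiPoly18.num 2) * num_expr b z ^ 2 * den_expr b z
    + (1 - BiPoly18.num 4 * b - b ^ 2 - b ^ 3) * num_expr b z * den_expr b z ^ 2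
    + (BiPoly18.num 2 * b + b ^ 3) * den_expr b z ^ 3 - b * phi_expr b z * cof_expr b z

/-- The cofactor in the elimination of `z`. -/
def Cof18 (b z : ℚ) : ℚ := (cof_expr .vb .vz).val b z

theorem elim_check : (elim_expr .vb .vz).maj 1 1 < 2 ^ 100 ∧
    (elim_expr .vb .vz).maj (2 ^ 100) 1 < 2 ^ 6000 ∧
    (elim_expr .vb .vz).valZ (2 ^ 100 : ℕ) (2 ^ 6000 : ℕ) = 0 := by
  decide +kernel

section
open BiPoly18

theorem val_add18 (b z : ℚ) (x y : BiPoly18) : (x + y).val b z = x.val b z + y.val b z := rfl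
theorem val_sub18 (b z : ℚ) (x y : BiPoly18) : (x - y).val b z = x.val b z - y.val b z :=
  (sub_eq_add_neg _ _).symm
theorem val_neg18 (b z : ℚ) (x : BiPoly18) : (-x).val b z = -x.val b z := rfl
theorem val_mul18 (b z : ℚ) (x y : BiPoly18) : (x * y).val b z = x.val b z * y.val b z := rfl
theorem val_pow18 (b z : ℚ) (x : BiPoly18) (n : ℕ) : (x ^ n).val b z = x.val b z ^ n := rfl
theorem val_num18 (b z : ℚ) (n : ℕ) :
    (num n).val b z = (n : ℚ) := rfl
theorem val_one18 (b z : ℚ) : (1 : BiPoly18).val b z = 1 := Nat.cast_one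
theorem val_vb18 (b z : ℚ) : vb.val b z = b := rfl
theorem val_vz18 (b z : ℚ) : vz.val b z = z := rfl

end

set_option maxHeartbeats 4000000 in
theorem dyn_aux (b z N2 L K M1 M2 : ℚ) (h2 : N2 = (z - 1) * (b * z + 1)) (hL : L = (b - 1) * z + 1)
    (hK : K = (b + 1) * z ^ 2 - (b - 1) * z - 1)
    (h1 : M1 = -b ^ 2 * z ^ 2 + (1 - 2 * b + b ^ 2) * z + (b - 1))
    (hM : M2 = N2 ^ 2 - b * (L * K)) :
    b * z * (z ^ 2 * M1 * M2) ^ 2 - (z ^ 2 * M1 * M2 - b * L ^ 2 * K ^ 2)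
      * (b * (z ^ 2 * M1 * M2) + b * L ^ 2 * K ^ 2) = b * (-(L * K) - z * N2 ^ 2) * Phi18 b z := by
  rw [hM, h1, hK, hL, h2]
  unfold Phi18
  ring

theorem elim_aux (b z N2 L K M1 M2 R D : ℚ) (h2 : N2 = (z - 1) * (b * z + 1))
    (hL : L = (b - 1) * z + 1)
    (hK : K = (b + 1) * z ^ 2 - (b - 1) * z - 1)
    (h1 : M1 = -b ^ 2 * z ^ 2 + (1 - 2 * b + b ^ 2) * z + (b - 1))
    (hM : M2 = N2 ^ 2 - b * (L * K))
    (hD : D = z ^ 2 * N2 ^ 2 * L ^ 2 * K ^ 2)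
    (hR : R = b ^ 2 * z * D + b * N2 ^ 3 * L ^ 2 * K ^ 2 - b ^ 2 * L ^ 3 * K ^ 3 * z ^ 2
      + b * z ^ 4 * M1 * M2 * N2 ^ 2 - (b ^ 3 + 2 * b ^ 2 - 2 * b) * D) :
    R ^ 3 + (b ^ 3 + b ^ 2 + 2 * b - 2) * R ^ 2 * D + (1 - 4 * b - b ^ 2 - b ^ 3) * R * D ^ 2
      + (2 * b + b ^ 3) * D ^ 3 = b * Phi18 b z * Cof18 b z := by
  have key := BiPoly18.kronecker _ _ _ elim_check.1 elim_check.2.1 elim_check.2.2 b z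
  have hden : (den_expr .vb .vz).val b z = D := by
    rw [hD, hK, hL, h2]
    simp only [den_expr, val_add18, val_sub18, val_mul18, val_pow18, val_one18, val_vb18, val_vz18]
  have hnum : (num_expr .vb .vz).val b z = R := by
    rw [hR, hM, h1, hK, hL, h2]
    simp only [num_expr, val_add18, val_sub18, val_neg18, val_mul18, val_pow18, val_num18,
      Nat.cast_ofNat, val_one18, val_vb18, val_vz18, hden]
  have hphi : (phi_expr .vb .vz).val b z = Phi18 b z := by
    simp only [phi_expr, Phi18, val_add18, val_sub18, val_neg18, val_mul18, val_pow18, val_num18,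
      Nat.cast_ofNat, val_one18, val_vb18, val_vz18]
  unfold elim_expr at key
  simp only [val_add18, val_sub18, val_mul18, val_pow18, val_num18,
    Nat.cast_ofNat, val_one18, val_vb18, val_vz18, hden, hnum, hphi] at key
  exact sub_eq_zero.1 key

theorem no_cycle (b z₁ z₂ z₃ z₄ : ℚ) (hb : b ≠ 0) (h1 : z₁ ≠ 0) (h2 : z₂ ≠ 0) (h3 : z₃ ≠ 0)
    (h13 : z₁ ≠ z₃)
    (e1 : (z₁ - 1) * (b * z₁ + 1) = z₂ * (b * z₁ ^ 2))
    (e2 : (z₂ - 1) * (b * z₂ + 1) = z₃ * (b * z₂ ^ 2))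
    (e3 : (z₃ - 1) * (b * z₃ + 1) = z₄ * (b * z₃ ^ 2))
    (e4 : (z₄ - 1) * (b * z₄ + 1) = z₁ * (b * z₄ ^ 2)) : False := by
  obtain ⟨z, hz⟩ : ∃ z, z = z₁ := ⟨_, rfl⟩
  rw [← hz] at e1 e4 h1 h13
  obtain ⟨N2, hN2⟩ : ∃ N2, N2 = (z - 1) * (b * z + 1) := ⟨_, rfl⟩
  obtain ⟨L, hL⟩ : ∃ L, L = (b - 1) * z + 1 := ⟨_, rfl⟩
  obtain ⟨K, hK⟩ : ∃ K, K = (b + 1) * z ^ 2 - (b - 1) * z - 1 := ⟨_, rfl⟩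
  obtain ⟨M1, hM1⟩ : ∃ M1, M1 = -b ^ 2 * z ^ 2 + (1 - 2 * b + b ^ 2) * z + (b - 1) := ⟨_, rfl⟩
  obtain ⟨M2, hM2⟩ : ∃ M2, M2 = N2 ^ 2 - b * (L * K) := ⟨_, rfl⟩
  have f2 : N2 = z₂ * (b * z ^ 2) := by rw [hN2, e1]
  have hN0 : N2 ≠ 0 := by
    rw [f2]; exact mul_ne_zero h2 (mul_ne_zero hb (pow_ne_zero 2 h1))
  -- the third point
  have f3 : -(L * K) = z₃ * N2 ^ 2 := by
    have i1 : N2 - b * z ^ 2 = -L := by rw [hN2, hL]; ring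
    have i2 : N2 + z ^ 2 = K := by rw [hN2, hK]; ring
    rw [f2] at i1 i2
    rw [f2, ← i2]
    have : L = -(z₂ * (b * z ^ 2) - b * z ^ 2) := by linarith
    rw [this]
    linear_combination (b * z ^ 4) * e2
  have hLK : L * K ≠ 0 := by
    intro h0
    rw [h0] at f3
    exact mul_ne_zero h3 (pow_ne_zero 2 hN0) (by linarith)
  -- the fourth point
  have f4 : z ^ 2 * M1 * M2 = z₄ * (b * L ^ 2 * K ^ 2) := by
    have i1 : -(L * K) - N2 ^ 2 = z ^ 2 * M1 := by rw [hL, hK, hN2, hM1]; ring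
    rw [← i1, hM2]
    have g : L * K = -(z₃ * N2 ^ 2) := by linarith
    have g2 : b * L ^ 2 * K ^ 2 = b * (L * K) ^ 2 := by ring
    rw [g2, g]
    linear_combination (N2 ^ 4) * e3
  have hphi : Phi18 b z = 0 := by
    have key := dyn_aux b z N2 L K M1 M2 hN2 hL hK hM1 hM2
    rw [f4, f3] at key
    have h0 : b * (z₃ * N2 ^ 2 - z * N2 ^ 2) * Phi18 b z = 0 := by
      rw [← key]
      linear_combination (-(b * L ^ 2 * K ^ 2) ^ 2) * e4
    refine (mul_eq_zero.1 h0).resolve_left (mul_ne_zero hb ?_)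
    rw [← sub_mul]
    exact mul_ne_zero (sub_ne_zero.2 h13.symm) (pow_ne_zero 2 hN0)
  obtain ⟨D, hD⟩ : ∃ D, D = z ^ 2 * N2 ^ 2 * L ^ 2 * K ^ 2 := ⟨_, rfl⟩
  have hD0 : D ≠ 0 := by
    have : D = z ^ 2 * N2 ^ 2 * (L * K) ^ 2 := by rw [hD]; ring
    rw [this]
    exact mul_ne_zero (mul_ne_zero (pow_ne_zero 2 h1) (pow_ne_zero 2 hN0)) (pow_ne_zero 2 hLK)
  obtain ⟨r, hr⟩ : ∃ r, r = b ^ 2 * (z + z₂ + z₃ + z₄) - b ^ 3 - 2 * b ^ 2 + 2 * b := ⟨_, rfl⟩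
  have key := elim_aux b z N2 L K M1 M2 (r * D) D hN2 hL hK hM1 hM2 hD (by
    rw [hr, hD]
    linear_combination (-(b * N2 ^ 2 * L ^ 2 * K ^ 2)) * f2 - (b ^ 2 * z ^ 2 * L ^ 2 * K ^ 2) * f3
      - (b * z ^ 2 * N2 ^ 2) * f4)
  rw [hphi] at key
  apply core18 b r hb
  have : D ^ 3 * (r ^ 3 + (b ^ 3 + b ^ 2 + 2 * b - 2) * r ^ 2 + (1 - 4 * b - b ^ 2 - b ^ 3) * r
      + (2 * b + b ^ 3)) = 0 := by
    linear_combination key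
  exact (mul_eq_zero.1 this).resolve_left (pow_ne_zero 3 hD0)

/-- The curve `P̃₄(a, t) = 0` has no rational points; consequently, for
`a ∉ {0, -1, -2}`, the map `φ_a(z) = ((a+1)z² - az - 1)/((a+1)z²)`
has no rational periodic point of period 4. -/
theorem stmt_18 :
    (¬ ∃ a t : ℚ,
      a ^ 7 * t - 2 * a ^ 6 * t ^ 2 + a ^ 5 * t ^ 3 - a ^ 7 +
        13 * a ^ 6 * t - 17 * a ^ 5 * t ^ 2 + 5 * a ^ 4 * t ^ 3 -
        7 * a ^ 6 + 53 * a ^ 5 * t - 47 * a ^ 4 * t ^ 2 +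
        10 * a ^ 3 * t ^ 3 - 6 * a ^ 5 + 80 * a ^ 4 * t -
        60 * a ^ 3 * t ^ 2 + 10 * a ^ 2 * t ^ 3 + 43 * a ^ 4 +
        42 * a ^ 3 * t - 38 * a ^ 2 * t ^ 2 + 5 * a * t ^ 3 +
        95 * a ^ 3 - 10 * a ^ 2 * t - 11 * a * t ^ 2 + t ^ 3 +
        89 * a ^ 2 - 19 * a * t - t ^ 2 + 42 * a - 6 * t + 9 = 0) ∧
    ∀ a : ℚ, a ≠ 0 → a ≠ -1 → a ≠ -2 →
      ¬ ∃ z₁ z₂ z₃ z₄ : ℚ,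
        z₁ ≠ 0 ∧ z₁ ≠ 1 ∧ z₂ ≠ 0 ∧ z₂ ≠ 1 ∧ z₃ ≠ 0 ∧ z₃ ≠ 1 ∧
        z₄ ≠ 0 ∧ z₄ ≠ 1 ∧ z₁ ≠ z₂ ∧ z₁ ≠ z₃ ∧
        ((a + 1) * z₁ ^ 2 - a * z₁ - 1) / ((a + 1) * z₁ ^ 2) = z₂ ∧
        ((a + 1) * z₂ ^ 2 - a * z₂ - 1) / ((a + 1) * z₂ ^ 2) = z₃ ∧
        ((a + 1) * z₃ ^ 2 - a * z₃ - 1) / ((a + 1) * z₃ ^ 2) = z₄ ∧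
        ((a + 1) * z₄ ^ 2 - a * z₄ - 1) / ((a + 1) * z₄ ^ 2) = z₁ := by
  refine ⟨?_, ?_⟩
  · rintro ⟨a, t, h⟩
    by_cases hb : a + 1 = 0
    · have ha : a = -1 := by linarith
      rw [ha] at h
      ring_nf at h
      norm_num at h
    · apply core18 (a + 1) ((a + 1) ^ 2 * t - (a + 1) ^ 3 - 2 * (a + 1) ^ 2 + 2 * (a + 1)) hb
      linear_combination (a + 1) * h
  · rintro a - ha1 - ⟨z₁, z₂, z₃, z₄, h1, -, h2, -, h3, -, h4, -, -, h13, e1, e2, e3, e4⟩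
    have hb : a + 1 ≠ 0 := fun h => ha1 (by linarith)
    have conv : ∀ x y : ℚ, x ≠ 0 → ((a + 1) * x ^ 2 - a * x - 1) / ((a + 1) * x ^ 2) = y →
        (x - 1) * ((a + 1) * x + 1) = y * ((a + 1) * x ^ 2) := by
      intro x y hx e
      rw [div_eq_iff (mul_ne_zero hb (pow_ne_zero 2 hx))] at e
      rw [← e]
      ring
    exact no_cycle (a + 1) z₁ z₂ z₃ z₄ hb h1 h2 h3 h13 (conv _ _ h1 e1) (conv _ _ h2 e2)
      (conv _ _ h3 e3) (conv _ _ h4 e4)
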